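/- arXiv:2004.14873 — 2 statements merged into one kernel-verified Lean document; each statement's English description precedes it below -/
import Mathlib

section
/- In the rational Cherednik algebra H_{t,c} of S_n acting on ℂ^n, the Dunkl–Opdam elements u_i = x_i y_i − c·Σ_{j<i}(ij) pairwise commute and are algebraically independent, so they generate a polynomial subalgebra of H_{t,c}. -/
/-- Generators of the rational Cherednik algebra `H_{t,c}(S_n, ℂ^n)`:
the `x_i`, the `y_i`, and the group elements of `S_n`. -/
inductive CherGen (n : ℕ) : Type
  | X : Fin n → CherGen n
  | Y : Fin n → CherGen n
  | G : Equiv.Perm (Fin n) → CherGen n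

noncomputable def xF (n : ℕ) (i : Fin n) : FreeAlgebra ℂ (CherGen n) :=
  FreeAlgebra.ι ℂ (CherGen.X i)

noncomputable def yF (n : ℕ) (i : Fin n) : FreeAlgebra ℂ (CherGen n) :=
  FreeAlgebra.ι ℂ (CherGen.Y i)

noncomputable def gF (n : ℕ) (w : Equiv.Perm (Fin n)) : FreeAlgebra ℂ (CherGen n) :=
  FreeAlgebra.ι ℂ (CherGen.G w)

/-- The defining relations of the rational Cherednik algebra `H_{t,c}(S_n, ℂ^n)`:
`S_n` group relations, the semidirect-product relations, commutativity of the
`x`'s and of the `y`'s, and `[y_i, x_j] = c·(ij)` for `i ≠ j`,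
`[y_i, x_i] = t − c·∑_{j ≠ i} (ij)`. -/
inductive CherRel (n : ℕ) (t c : ℂ) :
    FreeAlgebra ℂ (CherGen n) → FreeAlgebra ℂ (CherGen n) → Prop
  | gmul (w w' : Equiv.Perm (Fin n)) : CherRel n t c (gF n w * gF n w') (gF n (w * w'))
  | gone : CherRel n t c (gF n 1) 1
  | xx (i j : Fin n) : CherRel n t c (xF n i * xF n j) (xF n j * xF n i)
  | yy (i j : Fin n) : CherRel n t c (yF n i * yF n j) (yF n j * yF n i)
  | gx (w : Equiv.Perm (Fin n)) (i : Fin n) :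
      CherRel n t c (gF n w * xF n i) (xF n (w i) * gF n w)
  | gy (w : Equiv.Perm (Fin n)) (i : Fin n) :
      CherRel n t c (gF n w * yF n i) (yF n (w i) * gF n w)
  | yx (i j : Fin n) (h : i ≠ j) :
      CherRel n t c (yF n i * xF n j) (xF n j * yF n i + c • gF n (Equiv.swap i j))
  | yxd (i : Fin n) :
      CherRel n t c (yF n i * xF n i)
        (xF n i * yF n i + t • (1 : FreeAlgebra ℂ (CherGen n))
          - c • ∑ j ∈ Finset.univ.erase i, gF n (Equiv.swap i j))

/-- The rational Cherednik algebra `H_{t,c}(S_n, ℂ^n)`. -/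
noncomputable abbrev Cher (n : ℕ) (t c : ℂ) := RingQuot (CherRel n t c)

noncomputable def xC (n : ℕ) (t c : ℂ) (i : Fin n) : Cher n t c :=
  RingQuot.mkAlgHom ℂ (CherRel n t c) (xF n i)

noncomputable def yC (n : ℕ) (t c : ℂ) (i : Fin n) : Cher n t c :=
  RingQuot.mkAlgHom ℂ (CherRel n t c) (yF n i)

noncomputable def gC (n : ℕ) (t c : ℂ) (w : Equiv.Perm (Fin n)) : Cher n t c :=
  RingQuot.mkAlgHom ℂ (CherRel n t c) (gF n w)

/-- The Dunkl–Opdam element `u_i = x_i y_i − c·∑_{j < i} (ji)`. -/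
noncomputable def uC (n : ℕ) (t c : ℂ) (i : Fin n) : Cher n t c :=
  xC n t c i * yC n t c i -
    c • ∑ j ∈ Finset.univ.filter (fun j => j < i), gC n t c (Equiv.swap j i)

namespace Cher

section Relations

variable {n : ℕ} (t c : ℂ)

theorem g_mul (w w' : Equiv.Perm (Fin n)) :
    gC n t c w * gC n t c w' = gC n t c (w * w') := by
  simpa [gC] using RingQuot.mkAlgHom_rel ℂ (CherRel.gmul (t := t) (c := c) w w')

theorem y_comm (i j : Fin n) : yC n t c i * yC n t c j = yC n t c j * yC n t c i := by
  simpa [yC] using RingQuot.mkAlgHom_rel ℂ (CherRel.yy (t := t) (c := c) i j)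

theorem x_comm (i j : Fin n) : xC n t c i * xC n t c j = xC n t c j * xC n t c i := by
  simpa [xC] using RingQuot.mkAlgHom_rel ℂ (CherRel.xx (t := t) (c := c) i j)

theorem g_mul_x (w : Equiv.Perm (Fin n)) (i : Fin n) :
    gC n t c w * xC n t c i = xC n t c (w i) * gC n t c w := by
  simpa [gC, xC] using RingQuot.mkAlgHom_rel ℂ (CherRel.gx (t := t) (c := c) w i)

theorem g_mul_y (w : Equiv.Perm (Fin n)) (i : Fin n) :
    gC n t c w * yC n t c i = yC n t c (w i) * gC n t c w := by
  simpa [gC, yC] using RingQuot.mkAlgHom_rel ℂ (CherRel.gy (t := t) (c := c) w i)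

theorem y_mul_x {i j : Fin n} (h : i ≠ j) :
    yC n t c i * xC n t c j = xC n t c j * yC n t c i + c • gC n t c (Equiv.swap i j) := by
  simpa [gC, xC, yC] using RingQuot.mkAlgHom_rel ℂ (CherRel.yx (t := t) (c := c) i j h)

/-- The Jucys–Murphy element `∑_{k < j} (kj)`. -/
noncomputable def jucysMurphy (j : Fin n) : Cher n t c :=
  ∑ k ∈ Finset.univ.filter (fun k => k < j), gC n t c (Equiv.swap k j)

theorem u_eq (i : Fin n) :
    uC n t c i = xC n t c i * yC n t c i - c • jucysMurphy t c i := rfl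

theorem g_mul_xy (w : Equiv.Perm (Fin n)) (i : Fin n) :
    gC n t c w * (xC n t c i * yC n t c i) =
      xC n t c (w i) * yC n t c (w i) * gC n t c w := by
  rw [← mul_assoc, g_mul_x, mul_assoc, g_mul_y, mul_assoc]

theorem commute_g_jucysMurphy {w : Equiv.Perm (Fin n)} {j : Fin n} (hj : w j = j)
    (hw : ∀ k, w k < j ↔ k < j) : Commute (gC n t c w) (jucysMurphy t c j) := by
  rw [Commute, SemiconjBy, jucysMurphy, Finset.mul_sum, Finset.sum_mul]
  refine Finset.sum_equiv w (by simp [hw]) fun k _ => ?_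
  rw [g_mul, g_mul]
  conv_rhs => rw [← hj]
  rw [Equiv.mul_swap_eq_swap_mul, hj]

theorem commute_jucysMurphy {i j : Fin n} (h : i < j) :
    Commute (jucysMurphy t c i) (jucysMurphy t c j) := by
  refine Commute.sum_left _ _ _ fun k hk => ?_
  have hk' : k < i := by simpa using hk
  refine commute_g_jucysMurphy t c
    (Equiv.swap_apply_of_ne_of_ne (hk'.trans h).ne' h.ne') fun l => ?_
  rw [Equiv.swap_apply_def]
  split_ifs <;> grind

theorem commute_jucysMurphy_xy {i j : Fin n} (h : i < j) :
    Commute (jucysMurphy t c i) (xC n t c j * yC n t c j) := by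
  refine Commute.sum_left _ _ _ fun k hk => ?_
  have hk' : k < i := by simpa using hk
  rw [Commute, SemiconjBy, g_mul_xy, Equiv.swap_apply_of_ne_of_ne (hk'.trans h).ne' h.ne']

theorem xy_mul_jucysMurphy {i j : Fin n} (h : i < j) :
    xC n t c i * yC n t c i * jucysMurphy t c j -
      jucysMurphy t c j * (xC n t c i * yC n t c i) =
      xC n t c i * yC n t c i * gC n t c (Equiv.swap i j) -
        xC n t c j * yC n t c j * gC n t c (Equiv.swap i j) := by
  rw [jucysMurphy, Finset.mul_sum, Finset.sum_mul, ← Finset.sum_sub_distrib,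
    Finset.sum_eq_single i]
  · rw [g_mul_xy, Equiv.swap_apply_left]
  · intro k _ hk
    rw [g_mul_xy, Equiv.swap_apply_of_ne_of_ne hk.symm h.ne, sub_self]
  · intro hi
    simp [h] at hi

theorem xy_mul_xy {i j : Fin n} (h : i ≠ j) :
    xC n t c i * yC n t c i * (xC n t c j * yC n t c j) -
      xC n t c j * yC n t c j * (xC n t c i * yC n t c i) =
      c • (xC n t c i * yC n t c i * gC n t c (Equiv.swap i j) -
        xC n t c j * yC n t c j * gC n t c (Equiv.swap i j)) := by
  have key : ∀ {i j : Fin n}, i ≠ j →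
      xC n t c i * yC n t c i * (xC n t c j * yC n t c j) =
        xC n t c i * xC n t c j * (yC n t c i * yC n t c j) +
          c • (xC n t c i * yC n t c i * gC n t c (Equiv.swap i j)) := by
    intro i j h
    calc _ = xC n t c i * (yC n t c i * xC n t c j) * yC n t c j := by noncomm_ring
      _ = xC n t c i * xC n t c j * (yC n t c i * yC n t c j) +
          c • (xC n t c i * (gC n t c (Equiv.swap i j) * yC n t c j)) := by
        rw [y_mul_x t c h, mul_add, add_mul, mul_smul_comm, smul_mul_assoc]
        simp only [mul_assoc]
      _ = _ := by rw [g_mul_y, Equiv.swap_apply_right, mul_assoc (xC n t c i) (yC n t c i)]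
  rw [key h, key h.symm, x_comm t c j i, y_comm t c j i, Equiv.swap_comm j i, smul_sub]
  abel

theorem commute_u_of_lt {i j : Fin n} (h : i < j) : Commute (uC n t c i) (uC n t c j) := by
  have h₁ := xy_mul_xy t c h.ne
  have h₂ := xy_mul_jucysMurphy t c h
  have h₃ := (commute_jucysMurphy_xy t c h).eq
  have h₄ := (commute_jucysMurphy t c h).eq
  rw [← h₂] at h₁
  rw [commute_iff_lie_eq, Ring.lie_def, u_eq, u_eq]
  simp only [sub_mul, mul_sub, smul_mul_assoc, mul_smul_comm, h₃, h₄, smul_sub]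
  rw [smul_sub, sub_eq_iff_eq_add] at h₁
  rw [h₁]
  abel

theorem commute_u (i j : Fin n) : Commute (uC n t c i) (uC n t c j) := by
  rcases lt_trichotomy i j with h | rfl | h
  · exact commute_u_of_lt t c h
  · exact Commute.refl _
  · exact (commute_u_of_lt t c h).symm

end Relations

end Cher

namespace MvPolynomial

variable {σ R : Type*} [CommRing R]

theorem X_sub_X_dvd_sub_rename_swap [DecidableEq σ] (i j : σ) (f : MvPolynomial σ R) :
    (X i - X j : MvPolynomial σ R) ∣ f - rename (Equiv.swap i j) f := by
  induction f using MvPolynomial.induction_on with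
  | C a => simp
  | add p q hp hq =>
    rw [map_add, add_sub_add_comm]
    exact dvd_add hp hq
  | mul_X p k hp =>
    have hX : (X i - X j : MvPolynomial σ R) ∣ X k - X (Equiv.swap i j k) := by
      rw [Equiv.swap_apply_def]
      split_ifs with h h'
      · rw [h]
      · rw [h', ← neg_sub (X i)]
        exact dvd_neg.2 dvd_rfl
      · simp
    have : p * X k - rename (Equiv.swap i j) (p * X k) =
        (p - rename (Equiv.swap i j) p) * X k +
          rename (Equiv.swap i j) p * (X k - X (Equiv.swap i j k)) := by
      rw [map_mul, rename_X]
      ring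
    rw [this]
    exact dvd_add (hp.mul_right _) (hX.mul_left _)

theorem X_sub_X_ne_zero [Nontrivial R] {i j : σ} (h : i ≠ j) :
    (X i - X j : MvPolynomial σ R) ≠ 0 :=
  sub_ne_zero.2 fun e => h (X_injective e)

variable [IsDomain R] [DecidableEq σ]

/-- The divided difference `f ↦ (f - s_{ij} f) / (x_i - x_j)`, and `0` when `i = j`. -/
noncomputable def dividedDifference (i j : σ) : MvPolynomial σ R →ₗ[R] MvPolynomial σ R :=
  if h : i = j then 0 else
    { toFun := fun f => (X_sub_X_dvd_sub_rename_swap i j f).choose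
      map_add' := fun f g => by
        refine mul_left_cancel₀ (X_sub_X_ne_zero h) ?_
        rw [mul_add, ← (X_sub_X_dvd_sub_rename_swap i j (f + g)).choose_spec,
          ← (X_sub_X_dvd_sub_rename_swap i j f).choose_spec,
          ← (X_sub_X_dvd_sub_rename_swap i j g).choose_spec, map_add]
        ring
      map_smul' := fun a f => by
        refine mul_left_cancel₀ (X_sub_X_ne_zero h) ?_
        rw [RingHom.id_apply, mul_smul_comm,
          ← (X_sub_X_dvd_sub_rename_swap i j (a • f)).choose_spec,
          ← (X_sub_X_dvd_sub_rename_swap i j f).choose_spec, map_smul, smul_sub] }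

@[simp]
theorem dividedDifference_self (i : σ) : dividedDifference (R := R) i i = 0 := by
  simp [dividedDifference]

theorem X_sub_X_mul_dividedDifference {i j : σ} (h : i ≠ j) (f : MvPolynomial σ R) :
    (X i - X j) * dividedDifference i j f = f - rename (Equiv.swap i j) f := by
  rw [dividedDifference, dif_neg h]
  exact (X_sub_X_dvd_sub_rename_swap i j f).choose_spec.symm

theorem dividedDifference_eq_of_mul_eq {i j : σ} (h : i ≠ j) {f g : MvPolynomial σ R}
    (hg : (X i - X j) * g = f - rename (Equiv.swap i j) f) : dividedDifference i j f = g :=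
  mul_left_cancel₀ (X_sub_X_ne_zero h) ((X_sub_X_mul_dividedDifference h f).trans hg.symm)

@[simp]
theorem dividedDifference_C (i j : σ) (a : R) : dividedDifference i j (C a) = 0 := by
  by_cases h : i = j
  · simp [h]
  · exact dividedDifference_eq_of_mul_eq h (by simp)

theorem dividedDifference_X_left_mul {i j : σ} (h : i ≠ j) (f : MvPolynomial σ R) :
    dividedDifference i j (X i * f) =
      X i * dividedDifference i j f + rename (Equiv.swap i j) f := by
  refine dividedDifference_eq_of_mul_eq h ?_
  rw [map_mul, rename_X, Equiv.swap_apply_left]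
  linear_combination X i * X_sub_X_mul_dividedDifference h f

theorem dividedDifference_X_right_mul {i j : σ} (h : i ≠ j) (f : MvPolynomial σ R) :
    dividedDifference i j (X j * f) =
      X j * dividedDifference i j f - rename (Equiv.swap i j) f := by
  refine dividedDifference_eq_of_mul_eq h ?_
  rw [map_mul, rename_X, Equiv.swap_apply_right]
  linear_combination X j * X_sub_X_mul_dividedDifference h f

theorem dividedDifference_X_mul {i j k : σ} (hi : k ≠ i) (hj : k ≠ j)
    (f : MvPolynomial σ R) :
    dividedDifference i j (X k * f) = X k * dividedDifference i j f := by
  by_cases h : i = j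
  · simp [h]
  · refine dividedDifference_eq_of_mul_eq h ?_
    rw [map_mul, rename_X, Equiv.swap_apply_of_ne_of_ne hi hj]
    linear_combination X k * X_sub_X_mul_dividedDifference h f

theorem rename_dividedDifference (w : Equiv.Perm σ) (i j : σ) (f : MvPolynomial σ R) :
    rename w (dividedDifference i j f) = dividedDifference (w i) (w j) (rename w f) := by
  by_cases h : i = j
  · simp [h]
  · refine (dividedDifference_eq_of_mul_eq (w.injective.ne h) ?_).symm
    have hw : ⇑(Equiv.swap (w i) (w j)) ∘ ⇑w = ⇑w ∘ ⇑(Equiv.swap i j) := by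
      ext k
      exact congr_arg (· k) (Equiv.mul_swap_eq_swap_mul w i j).symm
    have key := congr_arg (rename w) (X_sub_X_mul_dividedDifference h f)
    rw [map_mul, map_sub, map_sub, rename_X, rename_X, rename_rename] at key
    rw [key, rename_rename, hw]

end MvPolynomial

section Dunkl

open MvPolynomial

variable {n : ℕ} (t c : ℂ)

/-- Multiplication by `x_i` on polynomials. -/
noncomputable def mulX (i : Fin n) : Module.End ℂ (MvPolynomial (Fin n) ℂ) :=
  LinearMap.mulLeft ℂ (X i)

/-- The action of a permutation on polynomials by renaming the variables. -/
noncomputable def permAct (w : Equiv.Perm (Fin n)) : Module.End ℂ (MvPolynomial (Fin n) ℂ) :=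
  (rename w).toLinearMap

/-- The Dunkl operator `t ∂_i - c ∑_j (1 - s_{ij}) / (x_i - x_j)`. -/
noncomputable def dunkl (i : Fin n) : Module.End ℂ (MvPolynomial (Fin n) ℂ) :=
  t • (pderiv i).toLinearMap - c • ∑ j ∈ Finset.univ.erase i, dividedDifference i j

theorem dunkl_apply (i : Fin n) (f : MvPolynomial (Fin n) ℂ) :
    dunkl t c i f =
      t • pderiv i f - c • ∑ j ∈ Finset.univ.erase i, dividedDifference i j f := by
  simp [dunkl]

theorem mulX_comm (i j : Fin n) : mulX i * mulX j = mulX j * mulX i := by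
  refine LinearMap.ext fun f => ?_
  simp only [mulX, Module.End.mul_apply, LinearMap.mulLeft_apply]
  ring

theorem permAct_mul (w w' : Equiv.Perm (Fin n)) :
    permAct w * permAct w' = permAct (w * w') := by
  refine LinearMap.ext fun f => ?_
  simp [permAct, rename_rename]

theorem permAct_one : permAct (1 : Equiv.Perm (Fin n)) = 1 := by
  refine LinearMap.ext fun f => ?_
  simp [permAct]

theorem permAct_mul_mulX (w : Equiv.Perm (Fin n)) (i : Fin n) :
    permAct w * mulX i = mulX (w i) * permAct w := by
  refine LinearMap.ext fun f => ?_
  simp [permAct, mulX]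

theorem permAct_mul_dunkl (w : Equiv.Perm (Fin n)) (i : Fin n) :
    permAct w * dunkl t c i = dunkl t c (w i) * permAct w := by
  refine LinearMap.ext fun f => ?_
  simp only [Module.End.mul_apply, dunkl_apply, permAct, AlgHom.toLinearMap_apply, map_sub,
    map_smul, map_sum, ← pderiv_rename w.injective,
    rename_dividedDifference]
  congr 2
  exact Finset.sum_equiv w (by simp) fun _ _ => rfl

theorem dunkl_mul_mulX {i j : Fin n} (h : i ≠ j) :
    dunkl t c i * mulX j = mulX j * dunkl t c i + c • permAct (Equiv.swap i j) := by
  refine LinearMap.ext fun f => ?_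
  have hj : j ∈ Finset.univ.erase i := by simp [h.symm]
  have hs : ∑ k ∈ (Finset.univ.erase i).erase j, dividedDifference i k (X j * f) =
      X j * ∑ k ∈ (Finset.univ.erase i).erase j, dividedDifference i k f := by
    rw [Finset.mul_sum]
    refine Finset.sum_congr rfl fun k hk => dividedDifference_X_mul h.symm ?_ f
    exact (Finset.ne_of_mem_erase hk).symm
  simp only [Module.End.mul_apply, LinearMap.add_apply, LinearMap.smul_apply, dunkl_apply,
    permAct, mulX, AlgHom.toLinearMap_apply, LinearMap.mulLeft_apply, Derivation.leibniz,
    pderiv_X_of_ne h.symm, ← Finset.add_sum_erase _ _ hj, hs,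
    dividedDifference_X_right_mul h, MvPolynomial.smul_eq_C_mul, smul_eq_mul]
  ring

theorem dunkl_mul_mulX_self (i : Fin n) :
    dunkl t c i * mulX i = mulX i * dunkl t c i + t • 1 -
      c • ∑ j ∈ Finset.univ.erase i, permAct (Equiv.swap i j) := by
  refine LinearMap.ext fun f => ?_
  have hs : ∑ k ∈ Finset.univ.erase i, dividedDifference i k (X i * f) =
      X i * ∑ k ∈ Finset.univ.erase i, dividedDifference i k f +
        ∑ k ∈ Finset.univ.erase i, rename (Equiv.swap i k) f := by
    rw [Finset.mul_sum, ← Finset.sum_add_distrib]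
    exact Finset.sum_congr rfl fun k hk =>
      dividedDifference_X_left_mul (Finset.ne_of_mem_erase hk).symm f
  simp only [Module.End.mul_apply, LinearMap.add_apply, LinearMap.sub_apply,
    LinearMap.smul_apply, LinearMap.sum_apply, dunkl_apply, Module.End.one_apply,
    permAct, mulX, AlgHom.toLinearMap_apply, LinearMap.mulLeft_apply, Derivation.leibniz,
    pderiv_X_self, hs, MvPolynomial.smul_eq_C_mul, smul_eq_mul]
  ring

theorem dunkl_apply_C (i : Fin n) (a : ℂ) : dunkl t c i (C a) = 0 := by
  simp [dunkl_apply]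

theorem commute_lie_dunkl_mulX_left {i j : Fin n} (h : i ≠ j) :
    Commute ⁅dunkl t c i, dunkl t c j⁆ (mulX i) := by
  have hs : ∑ k ∈ Finset.univ.erase i, (permAct (Equiv.swap i k) * dunkl t c j -
      dunkl t c j * permAct (Equiv.swap i k)) =
      permAct (Equiv.swap i j) * dunkl t c j - dunkl t c j * permAct (Equiv.swap i j) := by
    refine Finset.sum_eq_single_of_mem j (by simp [h.symm]) fun k _ hk => ?_
    rw [permAct_mul_dunkl, Equiv.swap_apply_of_ne_of_ne h.symm hk.symm, sub_self]
  have hij : permAct (Equiv.swap i j) * dunkl t c i =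
      dunkl t c j * permAct (Equiv.swap i j) := by
    rw [permAct_mul_dunkl, Equiv.swap_apply_left]
  have hji : permAct (Equiv.swap i j) * dunkl t c j =
      dunkl t c i * permAct (Equiv.swap i j) := by
    rw [permAct_mul_dunkl, Equiv.swap_apply_right]
  have h₁ : dunkl t c i * dunkl t c j * mulX i =
      mulX i * (dunkl t c i * dunkl t c j) + t • dunkl t c j -
        c • ∑ k ∈ Finset.univ.erase i, permAct (Equiv.swap i k) * dunkl t c j +
        c • (dunkl t c i * permAct (Equiv.swap i j)) := by
    rw [mul_assoc, dunkl_mul_mulX t c h.symm, mul_add, ← mul_assoc, dunkl_mul_mulX_self,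
      Equiv.swap_comm j i, mul_smul_comm, sub_mul, add_mul, smul_mul_assoc, smul_mul_assoc,
      Finset.sum_mul, one_mul, mul_assoc]
  have h₂ : dunkl t c j * dunkl t c i * mulX i =
      mulX i * (dunkl t c j * dunkl t c i) + c • (permAct (Equiv.swap i j) * dunkl t c i) +
        t • dunkl t c j -
        c • ∑ k ∈ Finset.univ.erase i, dunkl t c j * permAct (Equiv.swap i k) := by
    rw [mul_assoc, dunkl_mul_mulX_self, mul_sub, mul_add, ← mul_assoc,
      dunkl_mul_mulX t c h.symm, Equiv.swap_comm j i, add_mul, mul_smul_comm, mul_smul_comm,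
      smul_mul_assoc, Finset.mul_sum, mul_one, mul_assoc]
  rw [Finset.sum_sub_distrib, sub_eq_iff_eq_add] at hs
  rw [Commute, SemiconjBy, Ring.lie_def, sub_mul, mul_sub, h₁, h₂, hs, hij, hji]
  module

theorem commute_lie_dunkl_mulX (i j k : Fin n) :
    Commute ⁅dunkl t c i, dunkl t c j⁆ (mulX k) := by
  by_cases hij : i = j
  · simp [hij, Ring.lie_def]
  by_cases hik : i = k
  · subst hik
    exact commute_lie_dunkl_mulX_left t c hij
  by_cases hjk : j = k
  · subst hjk
    rw [← neg_neg ⁅dunkl t c i, dunkl t c j⁆, Ring.lie_def, neg_sub, ← Ring.lie_def]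
    exact (commute_lie_dunkl_mulX_left t c (Ne.symm hij)).neg_left
  have key : ∀ {i j : Fin n}, i ≠ j → i ≠ k → j ≠ k → dunkl t c i * dunkl t c j * mulX k =
      mulX k * (dunkl t c i * dunkl t c j) +
        c • (dunkl t c j * permAct (Equiv.swap i k)) +
        c • (dunkl t c i * permAct (Equiv.swap j k)) := by
    intro i j hij hik hjk
    rw [mul_assoc, dunkl_mul_mulX t c hjk, mul_add, ← mul_assoc, dunkl_mul_mulX t c hik,
      add_mul, smul_mul_assoc, permAct_mul_dunkl,
      Equiv.swap_apply_of_ne_of_ne (Ne.symm hij) hjk, mul_smul_comm, mul_assoc]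
  rw [Commute, SemiconjBy, Ring.lie_def, sub_mul, mul_sub, key hij hik hjk,
    key (Ne.symm hij) hjk hik]
  abel

theorem dunkl_comm (i j : Fin n) :
    dunkl t c i * dunkl t c j = dunkl t c j * dunkl t c i := by
  rw [← sub_eq_zero, ← Ring.lie_def]
  refine LinearMap.ext fun f => ?_
  induction f using MvPolynomial.induction_on with
  | C a => simp [Ring.lie_def, dunkl_apply_C]
  | add p q hp hq => rw [map_add, hp, hq, map_add]
  | mul_X p k hp =>
    have := congr_arg (· p) (commute_lie_dunkl_mulX t c i j k).eq
    simp only [Module.End.mul_apply, mulX, LinearMap.mulLeft_apply, hp] at this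
    rw [mul_comm, this]
    simp

end Dunkl

open Polynomial in
/-- The image of a generator under the polynomial representation, with the action of each
`y_i` shifted by a central indeterminate. -/
noncomputable def shiftedDunklGen (n : ℕ) (t c : ℂ) :
    CherGen n → (Module.End ℂ (MvPolynomial (Fin n) ℂ))[X]
  | .X i => C (mulX i)
  | .Y i => C (dunkl t c i) + X
  | .G w => C (permAct w)

namespace Cher

open Polynomial

section Representation

variable {n : ℕ} (t c : ℂ)

theorem lift_shiftedDunklGen_rel ⦃a b : FreeAlgebra ℂ (CherGen n)⦄ (h : CherRel n t c a b) :
    FreeAlgebra.lift ℂ (shiftedDunklGen n t c) a =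
      FreeAlgebra.lift ℂ (shiftedDunklGen n t c) b := by
  cases h <;>
    simp only [xF, yF, gF, shiftedDunklGen, map_mul, map_add, map_sub, map_smul, map_sum,
      map_one, FreeAlgebra.lift_ι_apply]
  case gmul w w' => rw [← C_mul, permAct_mul]
  case gone => rw [permAct_one, C_1]
  case xx i j => rw [← C_mul, mulX_comm, C_mul]
  case yy i j =>
    rw [add_mul, mul_add, mul_add, ← C_mul, dunkl_comm, C_mul, add_mul, mul_add, mul_add,
      X_mul_C, X_mul_C]
    abel
  case gx w i => rw [← C_mul, permAct_mul_mulX, C_mul]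
  case gy w i => rw [mul_add, ← C_mul, permAct_mul_dunkl, C_mul, add_mul, X_mul_C]
  case yx i j h =>
    rw [add_mul, mul_add, ← C_mul, dunkl_mul_mulX t c h, X_mul_C, C_add, C_mul, ← smul_C]
    abel
  case yxd i =>
    rw [add_mul, mul_add, ← C_mul, dunkl_mul_mulX_self, X_mul_C, C_sub, C_add, C_mul, ← smul_C,
      ← smul_C, C_1, map_sum]
    abel

/-- The polynomial representation by Dunkl operators, with the action of each `y_i` shifted by
a central indeterminate. -/
noncomputable def shiftedDunklRep :
    Cher n t c →ₐ[ℂ] (Module.End ℂ (MvPolynomial (Fin n) ℂ))[X] :=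
  RingQuot.liftAlgHom ℂ ⟨FreeAlgebra.lift ℂ (shiftedDunklGen n t c),
    lift_shiftedDunklGen_rel t c⟩

theorem exists_shiftedDunklRep_u (i : Fin n) :
    ∃ a, shiftedDunklRep t c (uC n t c i) = C (mulX i) * X + C a := by
  refine ⟨mulX i * dunkl t c i -
    c • ∑ j ∈ Finset.univ.filter (fun j => j < i), permAct (Equiv.swap j i), ?_⟩
  simp only [uC, xC, yC, gC, xF, yF, gF, shiftedDunklRep, map_sub, map_mul, map_smul, map_sum,
    RingQuot.liftAlgHom_mkAlgHom_apply, FreeAlgebra.lift_ι_apply, shiftedDunklGen, ← smul_C,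
    mul_add]
  abel

theorem natDegree_shiftedDunklRep_u_le (i : Fin n) :
    (shiftedDunklRep t c (uC n t c i)).natDegree ≤ 1 := by
  obtain ⟨a, ha⟩ := exists_shiftedDunklRep_u t c i
  rw [ha]
  exact natDegree_linear_le

theorem coeff_one_shiftedDunklRep_u (i : Fin n) :
    (shiftedDunklRep t c (uC n t c i)).coeff 1 = mulX i := by
  obtain ⟨a, ha⟩ := exists_shiftedDunklRep_u t c i
  simp [ha, coeff_C]

end Representation

theorem natDegree_prod_ofFn_pow_le {S : Type*} [Semiring S] {n : ℕ} {f : Fin n → S[X]}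
    (hf : ∀ i, (f i).natDegree ≤ 1) (m : Fin n → ℕ) :
    (List.ofFn fun i => f i ^ m i).prod.natDegree ≤ ∑ i, m i := by
  refine (natDegree_list_prod_le _).trans ?_
  rw [List.map_ofFn, List.sum_ofFn]
  refine Finset.sum_le_sum fun i _ => ?_
  simpa using natDegree_pow_le_of_le (m i) (hf i)

theorem coeff_prod_ofFn_pow {S : Type*} [Semiring S] {n : ℕ} {f : Fin n → S[X]}
    (hf : ∀ i, (f i).natDegree ≤ 1) (m : Fin n → ℕ) :
    (List.ofFn fun i => f i ^ m i).prod.coeff (∑ i, m i) =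
      (List.ofFn fun i => (f i).coeff 1 ^ m i).prod := by
  induction n with
  | zero => simp
  | succ n ih =>
    rw [List.ofFn_succ, List.prod_cons, Fin.sum_univ_succ, coeff_mul_add_eq_of_natDegree_le
      (by simpa using natDegree_pow_le_of_le (m 0) (hf 0))
      (natDegree_prod_ofFn_pow_le (fun i => hf i.succ) fun i => m i.succ),
      ih (fun i => hf i.succ) fun i => m i.succ, List.ofFn_succ, List.prod_cons]
    congr 1
    simpa using coeff_pow_of_natDegree_le (m := m 0) (hf 0)

theorem prod_ofFn_mulX_pow {n : ℕ} (m : Fin n →₀ ℕ) :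
    (List.ofFn fun i => mulX i ^ m i).prod 1 = MvPolynomial.monomial m (1 : ℂ) := by
  have h : (List.ofFn fun i => mulX i ^ m i).prod =
      Algebra.lmul ℂ (MvPolynomial (Fin n) ℂ)
        (List.ofFn fun i => MvPolynomial.X i ^ m i).prod := by
    rw [map_list_prod, List.map_ofFn]
    congr 2
    ext1 i
    exact (map_pow (Algebra.lmul ℂ (MvPolynomial (Fin n) ℂ)) (MvPolynomial.X i) (m i)).symm
  rw [h, List.prod_ofFn, MvPolynomial.monomial_eq, Finsupp.prod_fintype _ _ (by simp)]
  simp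

/-- The evaluation of polynomials at the Dunkl–Opdam elements, as a linear map. -/
noncomputable def evalU (n : ℕ) (t c : ℂ) : MvPolynomial (Fin n) ℂ →ₗ[ℂ] Cher n t c :=
  Module.Basis.constr (MvPolynomial.basisMonomials (Fin n) ℂ) ℂ
    fun m => (List.ofFn fun i : Fin n => uC n t c i ^ m i).prod

theorem evalU_apply (n : ℕ) (t c : ℂ) (p : MvPolynomial (Fin n) ℂ) :
    evalU n t c p = ∑ m ∈ p.support, MvPolynomial.coeff m p •
      (List.ofFn fun i : Fin n => uC n t c i ^ m i).prod := by
  conv_lhs => rw [p.as_sum, map_sum]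
  refine Finset.sum_congr rfl fun m _ => ?_
  rw [← mul_one (MvPolynomial.coeff m p), ← smul_eq_mul, ← MvPolynomial.smul_monomial, map_smul,
    smul_eq_mul, mul_one, evalU]
  congr 1
  exact Module.Basis.constr_basis (MvPolynomial.basisMonomials (Fin n) ℂ) ℂ _ m

theorem coeff_shiftedDunklRep_evalU {n : ℕ} (t c : ℂ) (p : MvPolynomial (Fin n) ℂ) :
    (shiftedDunklRep t c (evalU n t c p)).coeff p.totalDegree 1 =
      MvPolynomial.homogeneousComponent p.totalDegree p := by
  rw [evalU_apply, MvPolynomial.homogeneousComponent_apply, map_sum, finsetSum_coeff,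
    LinearMap.sum_apply, Finset.sum_filter]
  refine Finset.sum_congr rfl fun m hm => ?_
  rw [map_smul, coeff_smul, LinearMap.smul_apply, map_list_prod, List.map_ofFn]
  simp only [Function.comp_def, map_pow]
  have hdeg : m.degree = ∑ i, m i := Finsupp.degree_eq_sum m
  split_ifs with h
  · rw [← h, hdeg, coeff_prod_ofFn_pow (natDegree_shiftedDunklRep_u_le t c)]
    simp only [coeff_one_shiftedDunklRep_u]
    rw [prod_ofFn_mulX_pow, MvPolynomial.smul_monomial, smul_eq_mul, mul_one]
  · have hlt : ∑ i, m i < p.totalDegree := by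
      rw [← hdeg]
      exact lt_of_le_of_ne (MvPolynomial.le_totalDegree hm) h
    rw [coeff_eq_zero_of_natDegree_lt ((natDegree_prod_ofFn_pow_le
      (natDegree_shiftedDunklRep_u_le t c) m).trans_lt hlt)]
    simp

theorem evalU_injective (n : ℕ) (t c : ℂ) : Function.Injective (evalU n t c) := by
  refine (injective_iff_map_eq_zero _).2 fun p hp => ?_
  have h := coeff_shiftedDunklRep_evalU t c p
  rw [hp, map_zero, coeff_zero, LinearMap.zero_apply] at h
  by_contra hp0
  obtain ⟨m, hm, hdeg⟩ := p.support.exists_mem_eq_sup (MvPolynomial.support_nonempty.2 hp0)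
    Finsupp.degree
  have hm' := congr_arg (MvPolynomial.coeff m) h
  rw [MvPolynomial.coeff_homogeneousComponent, if_pos (show m.degree = p.totalDegree from hdeg.symm)] at hm'
  exact MvPolynomial.mem_support_iff.1 hm hm'.symm

end Cher

/-- the Dunkl–Opdam elements pairwise commute and are algebraically
independent (the evaluation of multivariable polynomials at `u_1,…,u_n` is
injective), so they generate a polynomial subalgebra of `H_{t,c}`. -/
theorem stmt_16 (n : ℕ) (t c : ℂ) :
    (∀ i j : Fin n, uC n t c i * uC n t c j = uC n t c j * uC n t c i) ∧
    Function.Injective (fun p : MvPolynomial (Fin n) ℂ =>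
      ∑ mono ∈ p.support, MvPolynomial.coeff mono p •
        (List.ofFn fun i : Fin n => uC n t c i ^ mono i).prod) := by
  refine ⟨fun i j => (Cher.commute_u t c i j).eq, ?_⟩
  simpa only [← Cher.evalU_apply] using Cher.evalU_injective n t c
end

section
/- The monoid of affine permutations w (bijections of ℤ with w(i+n)=w(i)+n) such that w(i) > 0 whenever i > 0 is generated by the simple transpositions s_1,...,s_{n−1} and π (where π(i)=i+1), subject only to the relations of S_n among the s_i together with s_i·π = π·s_{i−1} for 2 ≤ i ≤ n−1 and s_1·π² = π²·s_{n−1}. -/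
/-- The simple transposition `s_i` as an `n`-periodic permutation of `ℤ`. -/
def sFun (n i : ℕ) : ℤ → ℤ := fun x =>
  if x % n = (i : ℤ) % n then x + 1
  else if x % n = ((i : ℤ) + 1) % n then x - 1
  else x

/-- The affine permutation `π : x ↦ x + 1`. -/
def piF : ℤ → ℤ := fun x => x + 1

/-- The monoid of positive affine permutations: `n`-periodic bijections of `ℤ`
mapping positive integers to positive integers, as a submonoid of
`Function.End ℤ` (composition). -/
def AffPos (n : ℕ) : Submonoid (Function.End ℤ) where
  carrier := {f | Function.Bijective f ∧ (∀ i : ℤ, f (i + n) = f i + n) ∧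
    ∀ i : ℤ, 0 < i → 0 < f i}
  one_mem' := ⟨Function.bijective_id, fun _ => rfl, fun _ h => h⟩
  mul_mem' := by
    rintro f g ⟨hfb, hfp, hfpos⟩ ⟨hgb, hgp, hgpos⟩
    refine ⟨hfb.comp hgb, fun i => ?_, fun i hi => ?_⟩
    · show f (g (i + n)) = f (g i) + n
      rw [hgp, hfp]
    · exact hfpos _ (hgpos _ hi)

namespace AffPos

/-! ### Generators and relations -/

/-- The generators as endomorphisms of `ℤ`: letter `0` is `π`, letter `i ≥ 1` is `s_i`. -/
def act (n : ℕ) : ℕ → Function.End ℤ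
  | 0 => piF
  | i + 1 => sFun n (i + 1)

/-- The defining relations for a family whose `0`-th member plays the role of `π` and
whose `i`-th member, `1 ≤ i ≤ n - 1`, plays the role of `s_i`. -/
structure Relations {N : Type} [Monoid N] (n : ℕ) (G : ℕ → N) : Prop where
  sq : ∀ i, 1 ≤ i → i ≤ n - 1 → G i * G i = 1
  braid : ∀ i, 1 ≤ i → i + 1 ≤ n - 1 → G i * G (i + 1) * G i = G (i + 1) * G i * G (i + 1)
  comm : ∀ i j, 1 ≤ i → j ≤ n - 1 → i + 1 < j → G i * G j = G j * G i
  shift : ∀ i, 2 ≤ i → i ≤ n - 1 → G i * G 0 = G 0 * G (i - 1)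
  wrap : G 1 * (G 0 * G 0) = (G 0 * G 0) * G (n - 1)

theorem act_of_pos {n i : ℕ} (hi : 1 ≤ i) : act n i = sFun n i := by
  obtain ⟨j, rfl⟩ := Nat.exists_eq_add_of_le' hi
  rfl

theorem act_zero_apply (n : ℕ) (x : ℤ) : act n 0 x = x + 1 := rfl

theorem sFun_add_period (n i : ℕ) (x : ℤ) : sFun n i (x + n) = sFun n i x + n := by
  simp only [sFun, Int.add_emod_right]
  split_ifs <;> ring

theorem act_add_period (n a : ℕ) (x : ℤ) : act n a (x + n) = act n a x + n := by
  cases a with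
  | zero => simp only [act_zero_apply]; ring
  | succ i => exact sFun_add_period n (i + 1) x

/-- The action of `s_i` on the window `1, …, n`. -/
theorem sFun_window {n i : ℕ} (hi : 1 ≤ i) (hin : i + 1 ≤ n) {x : ℤ} (hx : 1 ≤ x) (hxn : x ≤ n) :
    sFun n i x = if x = i then (i : ℤ) + 1 else if x = i + 1 then (i : ℤ) else x := by
  have key : ∀ y : ℤ, 1 ≤ y → y ≤ n → (x % n = y % n ↔ x = y) := by
    intro y hy hyn
    refine ⟨fun h => ?_, fun h => by rw [h]⟩
    obtain ⟨k, hk⟩ := Int.ModEq.dvd h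
    have h1 : k < 1 := by by_contra! hc; nlinarith
    have h2 : -1 < k := by by_contra! hc; nlinarith
    have : k = 0 := by omega
    subst this
    linarith
  simp only [sFun, key i (by omega) (by omega), key (i + 1) (by omega) (by omega)]
  split_ifs <;> omega

theorem act_window {n i : ℕ} (hi : 1 ≤ i) (hin : i ≤ n - 1) {x : ℤ} (hx : 1 ≤ x)
    (hxn : x ≤ n) :
    act n i x = if x = i then (i : ℤ) + 1 else if x = i + 1 then (i : ℤ) else x := by
  rw [act_of_pos hi]
  exact sFun_window hi (by omega) hx hxn

theorem act_self {n i : ℕ} (hi : 1 ≤ i) (hin : i ≤ n - 1) : act n i i = i + 1 := by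
  rw [act_window hi hin (by omega) (by omega), if_pos rfl]

theorem act_succ {n i : ℕ} (hi : 1 ≤ i) (hin : i ≤ n - 1) : act n i (i + 1) = i := by
  rw [act_window hi hin (by omega) (by omega), if_neg (by omega), if_pos rfl]

theorem act_of_ne {n i : ℕ} (hi : 1 ≤ i) (hin : i ≤ n - 1) {x : ℤ} (hx : 1 ≤ x) (hxn : x ≤ n)
    (h1 : x ≠ i) (h2 : x ≠ i + 1) : act n i x = x := by
  rw [act_window hi hin hx hxn, if_neg h1, if_neg h2]

/-- Two `n`-periodic maps agreeing on the window `1, …, n` are equal. -/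
theorem periodic_ext {n : ℕ} (hn : 0 < n) {f g : ℤ → ℤ} (hf : ∀ x, f (x + n) = f x + n)
    (hg : ∀ x, g (x + n) = g x + n) (h : ∀ x : ℤ, 1 ≤ x → x ≤ n → f x = g x) : f = g := by
  have hmul : ∀ k : ℕ, ∀ x : ℤ, f x = g x ↔ f (x + n * k) = g (x + n * k) := by
    intro k x
    induction k with
    | zero => simp
    | succ k ih =>
      rw [ih, show x + n * ((k + 1 : ℕ) : ℤ) = x + n * k + n by push_cast; ring, hf, hg]
      exact (add_left_inj _).symm
  funext x
  have hn' : (0 : ℤ) < n := by exact_mod_cast hn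
  have e := Int.emod_add_mul_ediv (x - 1) n
  have h0 := Int.emod_nonneg (x - 1) hn'.ne'
  have h1 := Int.emod_lt_of_pos (x - 1) hn'
  have hw := h ((x - 1) % n + 1) (by omega) (by omega)
  obtain ⟨k, hk | hk⟩ := Int.eq_nat_or_neg ((x - 1) / n)
  · have := (hmul k _).1 hw
    rw [hk] at e
    rwa [show (x - 1) % n + 1 + n * (k : ℤ) = x by linarith] at this
  · rw [hmul k, show x + n * (k : ℤ) = (x - 1) % n + 1 by rw [hk] at e; linarith]
    exact hw

theorem act_relations {n : ℕ} (hn : 2 ≤ n) : Relations n (act n) := by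
  have hper : ∀ (f g : Function.End ℤ), (∀ x : ℤ, f (x + n) = f x + n) →
      (∀ x : ℤ, g (x + n) = g x + n) → ∀ x : ℤ, (f * g) (x + n) = (f * g) x + n := by
    intro f g hf hg x
    show f (g (x + n)) = f (g x) + n
    rw [hg, hf]
  have ha := act_add_period n
  have hw : ∀ i : ℕ, 1 ≤ i → i ≤ n - 1 → ∀ x : ℤ, 1 ≤ x → x ≤ n →
      act n i x = if x = i then (i : ℤ) + 1 else if x = i + 1 then (i : ℤ) else x :=
    fun i hi hin x hx hxn => act_window hi hin hx hxn
  refine ⟨?_, ?_, ?_, ?_, ?_⟩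
  · intro i hi hin
    refine periodic_ext (by omega) (hper _ _ (ha _) (ha _)) (fun _ => rfl) fun x hx hxn => ?_
    show act n i (act n i x) = x
    grind
  · intro i hi hin
    refine periodic_ext (by omega) (hper _ _ (hper _ _ (ha _) (ha _)) (ha _))
      (hper _ _ (hper _ _ (ha _) (ha _)) (ha _)) fun x hx hxn => ?_
    show act n i (act n (i + 1) (act n i x)) = act n (i + 1) (act n i (act n (i + 1) x))
    have hi' : i ≤ n - 1 := by omega
    have a1 := act_self hi hi'
    have a2 := act_succ hi hi'
    have a3 := act_of_ne hi hi' (x := i + 1 + 1) (by omega) (by omega) (by omega) (by omega)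
    have b1 := act_of_ne (by omega) hin (x := i) (by omega) (by omega) (by omega) (by omega)
    have b2 := act_self (by omega) hin
    have b3 := act_succ (by omega) hin
    push_cast at b2 b3
    by_cases e1 : x = i
    · rw [e1, a1, b1, a1, b2, a3]
    by_cases e2 : x = i + 1
    · rw [e2, a2, b1, a1, b2, a3, b3]
    by_cases e3 : x = i + 1 + 1
    · rw [e3, a3, b3, a2, b1]
    have a4 : act n i x = x := act_of_ne hi hi' hx hxn e1 e2
    have b4 : act n (i + 1) x = x := act_of_ne (by omega) hin hx hxn (by omega) (by omega)
    rw [a4, b4, a4, b4]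
  · intro i j hi hj hij
    refine periodic_ext (by omega) (hper _ _ (ha _) (ha _))
      (hper _ _ (ha _) (ha _)) fun x hx hxn => ?_
    show act n i (act n j x) = act n j (act n i x)
    have h1 := hw i hi (by omega)
    have h2 := hw j (by omega) hj
    by_cases e : x = i ∨ x = i + 1
    · have hj' : ∀ y : ℤ, 1 ≤ y → y < j → act n j y = y := fun y hy hyj => by
        rw [h2 _ hy (by omega), if_neg (by omega), if_neg (by omega)]
      have hi' := h1 x hx hxn
      rw [hj' x hx (by omega), hj' (act n i x) (by rw [hi']; split_ifs <;> omega)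
        (by rw [hi']; split_ifs <;> omega)]
    · have hi' : ∀ y : ℤ, 1 ≤ y → y ≤ n → y ≠ i → y ≠ i + 1 → act n i y = y :=
        fun y hy hyn n1 n2 => by rw [h1 _ hy hyn, if_neg n1, if_neg n2]
      have hj' := h2 x hx hxn
      rw [hi' x hx hxn (by tauto) (by tauto)]
      apply hi' <;> rw [hj'] <;> split_ifs <;> omega
  · intro i hi hin
    obtain ⟨j, rfl⟩ : ∃ j, i = j + 1 := ⟨i - 1, by omega⟩
    refine periodic_ext (by omega) (hper _ _ (ha _) (ha _))
      (hper _ _ (ha _) (ha _)) fun x hx hxn => ?_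
    show act n (j + 1) (x + 1) = act n j x + 1
    have h1 := hw j (by omega) (by omega) x hx hxn
    have h2 := hw (j + 1) (by omega) hin
    rcases hxn.lt_or_eq with hlt | rfl
    · rw [h2 _ (by omega) (by omega), h1]
      push_cast
      split_ifs <;> omega
    · rw [add_comm (n : ℤ), ha, h2 _ (by omega) (by omega), h1]
      push_cast
      split_ifs <;> omega
  · refine periodic_ext (by omega) (hper _ _ (ha _) (hper _ _ (ha _) (ha _)))
      (hper _ _ (hper _ _ (ha _) (ha _)) (ha _)) fun x hx hxn => ?_
    show act n 1 (x + 1 + 1) = act n (n - 1) x + 1 + 1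
    have h1 := hw (n - 1) (by omega) le_rfl x hx hxn
    have h2 := hw 1 le_rfl (by omega)
    rw [h1]
    by_cases hlt : x + 2 ≤ n
    · rw [h2 _ (by omega) (by omega)]
      push_cast
      split_ifs <;> omega
    · rw [show x + 1 + 1 = (x + 2 - n) + n by ring, ha, h2 _ (by omega) (by omega)]
      push_cast
      split_ifs <;> omega

/-! ### Inverses of positive affine permutations -/

/-- The inverses of positive affine permutations. -/
structure IsInvPos (n : ℕ) (g : Function.End ℤ) : Prop where
  bij : Function.Bijective g
  periodic : ∀ x : ℤ, g (x + n) = g x + n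
  nonpos : ∀ x : ℤ, x ≤ 0 → g x ≤ 0

/-- The letter `a` can be cancelled on the right of `g`: for `a = 0` the composite `g ∘ π` still
maps nonpositive integers to nonpositive integers, for `a ≥ 1` the map `g` has a descent at `a`. -/
def IsDescent (g : Function.End ℤ) : ℕ → Prop
  | 0 => g 1 ≤ 0
  | i + 1 => g ((i + 1 : ℕ) + 1) < g (i + 1 : ℕ)

theorem isDescent_of_pos {g : Function.End ℤ} {i : ℕ} (hi : 1 ≤ i) :
    IsDescent g i ↔ g (i + 1) < g i := by
  obtain ⟨j, rfl⟩ := Nat.exists_eq_add_of_le' hi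
  rfl

section

variable {n : ℕ} {g : Function.End ℤ}

theorem act_bijective (hn : 2 ≤ n) {a : ℕ} (ha : a ≤ n - 1) : Function.Bijective (act n a) := by
  rcases Nat.eq_zero_or_pos a with rfl | h
  · exact (Equiv.addRight (1 : ℤ)).bijective
  · exact Function.Involutive.bijective fun x =>
      congrFun ((act_relations hn).sq a h ha) x

/-- `s_i` preserves the nonpositive integers and the positive integers. -/
theorem act_pos_iff {i : ℕ} (hn : 2 ≤ n) (hi : 1 ≤ i) (hin : i ≤ n - 1) (x : ℤ) :
    0 < act n i x ↔ 0 < x := by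
  have hn' : (0 : ℤ) < n := by omega
  have hmul : ∀ (k : ℤ) (y : ℤ), act n i (y + n * k) = act n i y + n * k := by
    intro k y
    rw [act_of_pos hi]
    simp only [sFun, Int.add_mul_emod_self_left]
    split_ifs <;> ring
  have e := Int.emod_add_mul_ediv (x - 1) n
  have h0 := Int.emod_nonneg (x - 1) hn'.ne'
  have h1 := Int.emod_lt_of_pos (x - 1) hn'
  have hw := act_window hi hin (x := (x - 1) % n + 1) (by omega) (by omega)
  have hx := hmul ((x - 1) / n) ((x - 1) % n + 1)
  rw [show (x - 1) % n + 1 + n * ((x - 1) / n) = x by linarith] at hx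
  have hb : 1 ≤ act n i ((x - 1) % n + 1) ∧ act n i ((x - 1) % n + 1) ≤ n := by
    rw [hw]; split_ifs <;> omega
  rw [hx]
  generalize (x - 1) / (n : ℤ) = q at *
  generalize act n i ((x - 1) % n + 1) = v at *
  generalize (x - 1) % (n : ℤ) = r at *
  rcases lt_or_ge q 0 with hq | hq
  · constructor <;> intro <;> nlinarith
  · constructor <;> intro <;> nlinarith

theorem IsInvPos.mul_act (hn : 2 ≤ n) (hg : IsInvPos n g) {a : ℕ} (ha : a ≤ n - 1)
    (hd : a = 0 → g 1 ≤ 0) : IsInvPos n (g * act n a) := by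
  refine ⟨hg.bij.comp (act_bijective hn ha), fun x => ?_, fun x hx => ?_⟩
  · show g (act n a (x + n)) = g (act n a x) + n
    rw [act_add_period, hg.periodic]
  · show g (act n a x) ≤ 0
    rcases Nat.eq_zero_or_pos a with rfl | h
    · rw [act_zero_apply]
      rcases hx.lt_or_eq with h | rfl
      · exact hg.nonpos _ (by omega)
      · simpa using hd rfl
    · exact hg.nonpos _ (by have := act_pos_iff hn h ha x; omega)

theorem IsInvPos.le_of_le (hg : IsInvPos n g) {x : ℤ} (hx : x ≤ n) : g x ≤ n := by
  have h := hg.periodic (x - n)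
  have := hg.nonpos (x - n) (by omega)
  rw [sub_add_cancel] at h
  omega

/-! ### A well-founded order -/

/-- `n` times the degree of the inverse of `g`, up to a constant. -/
def deg (n : ℕ) (g : Function.End ℤ) : ℤ := ∑ k ∈ Finset.range n, (n - g (k + 1))

/-- A weighted version of `deg` that decreases when a descent is removed. -/
def weight (n : ℕ) (g : Function.End ℤ) : ℤ :=
  ∑ k ∈ Finset.range n, ((k : ℤ) + 1) * (n - g (k + 1))

/-- The lexicographic order defined by `deg` and `weight`. -/
def Lower (n : ℕ) (h g : Function.End ℤ) : Prop :=
  deg n h < deg n g ∨ deg n h = deg n g ∧ weight n h < weight n g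

theorem Lower.trans {f h : Function.End ℤ} (h1 : Lower n f h) (h2 : Lower n h g) :
    Lower n f g := by
  unfold Lower at *
  omega

theorem IsInvPos.induction {p : Function.End ℤ → Prop}
    (step : ∀ g, IsInvPos n g → (∀ h, IsInvPos n h → Lower n h g → p h) → p g)
    (hg : IsInvPos n g) : p g := by
  have key : ∀ d b : ℕ, ∀ g, IsInvPos n g → (deg n g).toNat = d → (weight n g).toNat = b →
      p g := by
    intro d
    induction d using Nat.strong_induction_on with
    | _ d ihd =>
      intro b
      induction b using Nat.strong_induction_on with
      | _ b ihb =>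
        intro g hg hd hb
        have hterm : ∀ h, IsInvPos n h → ∀ k ∈ Finset.range n, (0 : ℤ) ≤ n - h (k + 1) := by
          intro h hh k hk
          have := hh.le_of_le (x := k + 1) (by have := Finset.mem_range.1 hk; omega)
          omega
        have hdeg : ∀ h, IsInvPos n h → 0 ≤ deg n h := fun h hh =>
          Finset.sum_nonneg (hterm h hh)
        have hwt : ∀ h, IsInvPos n h → 0 ≤ weight n h := fun h hh =>
          Finset.sum_nonneg fun k hk => mul_nonneg (by omega) (hterm h hh k hk)
        refine step g hg fun h hh hlt => ?_
        have := hdeg g hg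
        have := hdeg h hh
        have := hwt g hg
        have := hwt h hh
        rcases hlt with hlt | ⟨heq, hlt⟩
        · exact ihd _ (by omega) _ h hh rfl rfl
        · exact ihb _ (by omega) h hh (by omega) rfl
  exact key _ _ g hg rfl rfl

theorem lower_mul_act_zero (hn : 2 ≤ n) (hg : IsInvPos n g) : Lower n (g * act n 0) g := by
  left
  have h1 := Finset.sum_range_succ (fun k : ℕ => (n : ℤ) - g (k + 1)) n
  rw [Finset.sum_range_succ'] at h1
  have h2 : deg n (g * act n 0) = ∑ k ∈ Finset.range n, ((n : ℤ) - g ((k + 1 : ℕ) + 1)) :=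
    Finset.sum_congr rfl fun k _ => by
      show (n : ℤ) - g (k + 1 + 1) = _
      push_cast; rfl
  have h3 := hg.periodic 1
  rw [add_comm] at h3
  rw [h2]
  simp only [Nat.cast_zero, zero_add] at h1
  show _ < ∑ k ∈ Finset.range n, ((n : ℤ) - g (k + 1))
  omega

theorem lower_mul_act (hn : 2 ≤ n) (hg : IsInvPos n g) {a : ℕ} (ha : a ≤ n - 1)
    (hd : IsDescent g a) : Lower n (g * act n a) g := by
  cases a with
  | zero => exact lower_mul_act_zero hn hg
  | succ j =>
    have hd' : g (j + 1 + 1) < g (j + 1) := by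
      have := hd
      simp only [IsDescent] at this
      push_cast at this
      exact this
    have hw : ∀ k ∈ Finset.range n, (g * act n (j + 1)) (k + 1) =
        if k = j then g (j + 1 + 1) else if k = j + 1 then g (j + 1) else g (k + 1) := by
      intro k hk
      have hk := Finset.mem_range.1 hk
      show g (act n (j + 1) (k + 1)) = _
      rw [act_window (by omega) ha (by omega) (by omega)]
      push_cast
      split_ifs <;> first | rfl | omega
    have hj : j ∈ Finset.range n := Finset.mem_range.2 (by omega)
    have hj' : j + 1 ∈ Finset.range n := Finset.mem_range.2 (by omega)
    right
    constructor
    · unfold deg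
      rw [← sub_eq_zero, ← Finset.sum_sub_distrib,
        Finset.sum_eq_add j (j + 1) (by omega) _ (fun h => absurd hj h) (fun h => absurd hj' h)]
      · rw [hw _ hj, hw _ hj']
        simp
      · rintro k hk ⟨h1, h2⟩
        rw [hw k hk, if_neg h1, if_neg h2, sub_self]
    · unfold weight
      rw [← sub_neg, ← Finset.sum_sub_distrib,
        Finset.sum_eq_add j (j + 1) (by omega) _ (fun h => absurd hj h) (fun h => absurd hj' h)]
      · rw [hw _ hj, hw _ hj']
        simp
        nlinarith
      · rintro k hk ⟨h1, h2⟩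
        rw [hw k hk, if_neg h1, if_neg h2, sub_self]

/-- Only the identity has no descent. -/
theorem IsInvPos.eq_one (hn : 2 ≤ n) (hg : IsInvPos n g)
    (h : ∀ a ≤ n - 1, ¬ IsDescent g a) : g = 1 := by
  have h1 : 1 ≤ g 1 := by
    have := h 0 (by omega)
    simp only [IsDescent] at this
    omega
  have hge : ∀ k : ℕ, k + 1 ≤ n → (k : ℤ) + 1 ≤ g (k + 1) := by
    intro k
    induction k with
    | zero => intro _; simpa using h1
    | succ k ih =>
      intro hk
      have h2 := h (k + 1) (by omega)
      simp only [IsDescent] at h2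
      have := ih (by omega)
      have hne : g ((k + 1 : ℕ) + 1) ≠ g (k + 1 : ℕ) := fun e => by
        have := hg.bij.1 e
        omega
      push_cast at *
      omega
  -- downward induction on the window, using `g x ≤ n` for `x ≤ n` and injectivity
  have hdown : ∀ m : ℕ, m < n → g ((n : ℤ) - m) = (n : ℤ) - m := by
    intro m
    induction m using Nat.strong_induction_on with
    | _ m ih =>
      intro hm
      have hlow := hge (n - m - 1) (by omega)
      rw [show (((n - m - 1 : ℕ) : ℤ) + 1) = (n : ℤ) - m by omega] at hlow
      by_contra hne
      have hup := hg.le_of_le (x := (n : ℤ) - m) (by omega)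
      obtain ⟨q, hq⟩ : ∃ q : ℕ, g ((n : ℤ) - m) = (n : ℤ) - q :=
        ⟨(n - g ((n : ℤ) - m)).toNat, by omega⟩
      have hqm : q < m := by omega
      have := hg.bij.1 (hq.trans (ih q hqm (by omega)).symm)
      omega
  refine periodic_ext (by omega) hg.periodic (fun _ => rfl) fun x hx hxn => ?_
  have := hdown (n - x).toNat (by omega)
  rw [show (n : ℤ) - ((n - x).toNat : ℕ) = x by omega] at this
  exact this

end

/-! ### Reduced expressions and their values -/

section

variable {n : ℕ} {N : Type} [Monoid N] {G : ℕ → N}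

/-- `Value n G g x` says that `x` is the value, under `a ↦ G a`, of a word obtained by
successively cancelling descents of `g` until the identity is reached. -/
inductive Value (n : ℕ) (G : ℕ → N) : Function.End ℤ → N → Prop
  | one : Value n G 1 1
  | step {g : Function.End ℤ} {a : ℕ} {x : N} (ha : a ≤ n - 1) (hd : IsDescent g a)
      (h : Value n G (g * act n a) x) : Value n G g (G a * x)

theorem not_isDescent_one (a : ℕ) : ¬ IsDescent 1 a := by
  cases a with
  | zero => exact not_le.2 (show (0 : ℤ) < 1 by norm_num)
  | succ i =>
    intro h
    have h : ((i + 1 : ℕ) : ℤ) + 1 < (i + 1 : ℕ) := h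
    omega

theorem mul_act_mul_act (hn : 2 ≤ n) (g : Function.End ℤ) {i : ℕ} (hi : 1 ≤ i)
    (hin : i ≤ n - 1) : g * act n i * act n i = g := by
  rw [mul_assoc, (act_relations hn).sq i hi hin, mul_one]

/-- Exactly one of `g` and `g ∘ s_i` has a descent at `i`. -/
theorem isDescent_mul_act_self {g : Function.End ℤ} (hg : IsInvPos n g) {i : ℕ}
    (hi : 1 ≤ i) (hin : i ≤ n - 1) : IsDescent (g * act n i) i ↔ ¬ IsDescent g i := by
  rw [isDescent_of_pos hi, isDescent_of_pos hi]
  show g (act n i (i + 1)) < g (act n i i) ↔ _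
  rw [act_self hi hin, act_succ hi hin]
  have : g (i + 1) ≠ g i := fun e => by
    have := hg.bij.1 e
    omega
  omega

/-- If values are unique below `g`, then cancelling two different descents of `g` leads to
the same value. -/
theorem value_confluent (hn : 2 ≤ n) (hG : Relations n G) {g : Function.End ℤ}
    (hg : IsInvPos n g) (ih : ∀ h, IsInvPos n h → Lower n h g → ∃! x, Value n G h x)
    {a b : ℕ} (hab : a < b) (hb : b ≤ n - 1) (hda : IsDescent g a) (hdb : IsDescent g b)
    {x y : N} (hx : Value n G (g * act n a) x) (hy : Value n G (g * act n b) y) :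
    G a * x = G b * y := by
  have hR := act_relations hn
  have ha : a ≤ n - 1 := by omega
  have pos : ∀ {h : Function.End ℤ} {c : ℕ}, IsInvPos n h → c ≤ n - 1 → IsDescent h c →
      IsInvPos n (h * act n c) := fun hh hc hd => hh.mul_act hn hc (by rintro rfl; exact hd)
  have ga := pos hg ha hda
  have gb := pos hg hb hdb
  have la := lower_mul_act hn hg ha hda
  have lb := lower_mul_act hn hg hb hdb
  have uniq : ∀ {h : Function.End ℤ} {u v : N}, IsInvPos n h → Lower n h g →
      Value n G h u → Value n G h v → u = v := fun hh hl hu hv => (ih _ hh hl).unique hu hv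
  rcases Nat.eq_zero_or_pos a with rfl | hpos
  · rcases Nat.lt_or_ge b 2 with hb2 | hb2
    · obtain rfl : b = 1 := by omega
      have h1 : g 1 ≤ 0 := hda
      have h21 : g 2 < g 1 := hdb
      have e : g * act n 1 * act n 0 * act n 0 = g * act n 0 * act n 0 * act n (n - 1) := by
        simp only [mul_assoc]
        rw [hR.wrap, mul_assoc]
      have d0 : IsDescent (g * act n 0) 0 := show g 2 ≤ 0 by omega
      have e1 : act n 1 1 = 2 := by simpa using act_self (n := n) (i := 1) le_rfl hb
      have e2 : act n 1 2 = 1 := by simpa using act_succ (n := n) (i := 1) le_rfl hb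
      have d1 : IsDescent (g * act n 1) 0 := by
        show g (act n 1 1) ≤ 0
        rw [e1]; omega
      have d2 : IsDescent (g * act n 1 * act n 0) 0 := by
        show g (act n 1 2) ≤ 0
        rw [e2]; omega
      have g00 := pos ga ha d0
      have g10 := pos gb ha d1
      have g100 := pos g10 ha d2
      have l00 := (lower_mul_act hn ga ha d0).trans la
      have l10 := (lower_mul_act hn gb ha d1).trans lb
      have l100 := (lower_mul_act hn g10 ha d2).trans l10
      obtain ⟨u, hu, -⟩ := ih _ g00 l00
      obtain ⟨v, hv, -⟩ := ih _ g100 l100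
      have hxu : x = G 0 * u := uniq ga la hx (.step ha d0 hu)
      have hyv : y = G 0 * (G 0 * v) := uniq gb lb hy (.step ha d1 (.step ha d2 hv))
      have hn1 : 1 ≤ n - 1 := by omega
      have huv : u = G (n - 1) * v := by
        by_cases hd : IsDescent (g * act n 0 * act n 0) (n - 1)
        · exact uniq g00 l00 hu (.step le_rfl hd (e ▸ hv))
        · have hd' := (isDescent_mul_act_self g00 hn1 le_rfl).2 hd
          rw [← e] at hd'
          have := uniq g100 l100 hv (.step le_rfl hd'
            (by rw [e, mul_act_mul_act hn _ hn1 le_rfl]; exact hu))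
          rw [this, ← mul_assoc, hG.sq _ hn1 le_rfl, one_mul]
      have hw := hG.wrap
      calc G 0 * x = G 0 * G 0 * G (n - 1) * v := by rw [hxu, huv]; simp only [mul_assoc]
        _ = G 1 * y := by rw [← hw, hyv]; simp only [mul_assoc]
    · obtain ⟨c, rfl⟩ : ∃ c, b = c + 1 := ⟨b - 1, by omega⟩
      have e : g * act n (c + 1) * act n 0 = g * act n 0 * act n c := by
        rw [mul_assoc, hR.shift _ hb2 hb, Nat.add_sub_cancel, mul_assoc]
      have hdb' := (isDescent_of_pos (by omega)).1 hdb
      push_cast at hdb'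
      have d1 : IsDescent (g * act n 0) c := (isDescent_of_pos (by omega)).2 hdb'
      have d2 : IsDescent (g * act n (c + 1)) 0 := by
        show g (act n (c + 1) 1) ≤ 0
        rw [act_of_ne (by omega) hb le_rfl (by omega) (by push_cast; omega) (by push_cast; omega)]
        exact hda
      obtain ⟨u, hu, -⟩ := ih _ (pos gb ha d2) ((lower_mul_act hn gb ha d2).trans lb)
      have hyu : y = G 0 * u := uniq gb lb hy (.step ha d2 hu)
      have hxu : x = G c * u := uniq ga la hx (.step (by omega) d1 (e ▸ hu))
      have := hG.shift _ hb2 hb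
      rw [Nat.add_sub_cancel] at this
      rw [hxu, hyu, ← mul_assoc, ← mul_assoc, this]
  · have ia := (isDescent_of_pos hpos).1 hda
    have ib := (isDescent_of_pos (by omega)).1 hdb
    have a1 := act_self hpos ha
    have a2 := act_succ hpos ha
    have b1 := act_self (by omega) hb
    have b2 := act_succ (by omega) hb
    rcases Nat.lt_or_ge (a + 1) b with hlt | hge
    · have e : g * act n b * act n a = g * act n a * act n b := by
        rw [mul_assoc, mul_assoc, hR.comm a b hpos hb hlt]
      have d1 : IsDescent (g * act n a) b := by
        rw [isDescent_of_pos (by omega)]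
        show g (act n a (b + 1)) < g (act n a b)
        rw [act_of_ne hpos ha (by omega) (by omega) (by omega) (by omega),
          act_of_ne hpos ha (by omega) (by omega) (by omega) (by omega)]
        exact ib
      have d2 : IsDescent (g * act n b) a := by
        rw [isDescent_of_pos hpos]
        show g (act n b (a + 1)) < g (act n b a)
        rw [act_of_ne (by omega) hb (by omega) (by omega) (by omega) (by omega),
          act_of_ne (by omega) hb (by omega) (by omega) (by omega) (by omega)]
        exact ia
      obtain ⟨u, hu, -⟩ := ih _ (pos gb ha d2) ((lower_mul_act hn gb ha d2).trans lb)
      have hyu : y = G a * u := uniq gb lb hy (.step ha d2 hu)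
      have hxu : x = G b * u := uniq ga la hx (.step hb d1 (e ▸ hu))
      rw [hxu, hyu, ← mul_assoc, ← mul_assoc, hG.comm a b hpos hb hlt]
    · obtain rfl : b = a + 1 := by omega
      push_cast at ib b1 b2
      have a3 := act_of_ne hpos ha (x := a + 1 + 1) (by omega) (by omega) (by omega) (by omega)
      have b3 := act_of_ne (by omega) hb (x := a) (by omega) (by omega) (by omega) (by omega)
      have e : g * act n (a + 1) * act n a * act n (a + 1) =
          g * act n a * act n (a + 1) * act n a := by
        have := hR.braid a hpos hb
        simp only [mul_assoc] at this ⊢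
        rw [this]
      have d1 : IsDescent (g * act n a) (a + 1) := by
        rw [isDescent_of_pos (by omega)]
        show g (act n a ((a + 1 : ℕ) + 1)) < g (act n a (a + 1 : ℕ))
        push_cast
        rw [a2, a3]
        omega
      have d2 : IsDescent (g * act n a * act n (a + 1)) a := by
        rw [isDescent_of_pos hpos]
        show g (act n a (act n (a + 1) (a + 1))) < g (act n a (act n (a + 1) a))
        rw [b1, b3, a1, a3]
        omega
      have d3 : IsDescent (g * act n (a + 1)) a := by
        rw [isDescent_of_pos hpos]
        show g (act n (a + 1) (a + 1)) < g (act n (a + 1) a)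
        rw [b1, b3]
        omega
      have d4 : IsDescent (g * act n (a + 1) * act n a) (a + 1) := by
        rw [isDescent_of_pos (by omega)]
        show g (act n (a + 1) (act n a ((a + 1 : ℕ) + 1))) <
          g (act n (a + 1) (act n a (a + 1 : ℕ)))
        push_cast
        rw [a2, a3, b2, b3]
        omega
      have gba := pos gb ha d3
      obtain ⟨u, hu, -⟩ := ih _ (pos gba hb d4) ((lower_mul_act hn gba hb d4).trans
        ((lower_mul_act hn gb ha d3).trans lb))
      have hyu : y = G a * (G (a + 1) * u) := uniq gb lb hy (.step ha d3 (.step hb d4 hu))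
      have hxu : x = G (a + 1) * (G a * u) :=
        uniq ga la hx (.step hb d1 (.step ha d2 (e ▸ hu)))
      have := hG.braid a hpos hb
      rw [hxu, hyu]
      simp only [← mul_assoc]
      rw [this]

theorem existsUnique_value (hn : 2 ≤ n) (hG : Relations n G) {g : Function.End ℤ}
    (hg : IsInvPos n g) : ∃! x, Value n G g x := by
  refine IsInvPos.induction (p := fun g => ∃! x, Value n G g x) (fun g hg ih => ?_) hg
  by_cases h1 : g = 1
  · subst h1
    refine ⟨1, .one, fun y hy => ?_⟩
    generalize hk : (1 : Function.End ℤ) = k at hy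
    cases hy with
    | one => rfl
    | step ha hd h => exact absurd (hk ▸ hd) (not_isDescent_one _)
  · obtain ⟨a, ha, hd⟩ : ∃ a ≤ n - 1, IsDescent g a := by
      by_contra! hc
      exact h1 (hg.eq_one hn hc)
    obtain ⟨x, hx, hux⟩ := ih _ (hg.mul_act hn ha (by rintro rfl; exact hd))
      (lower_mul_act hn hg ha hd)
    refine ⟨G a * x, .step ha hd hx, fun y hy => ?_⟩
    cases hy with
    | one => exact absurd rfl h1
    | @step _ b z hb hd' h =>
      rcases lt_trichotomy a b with hab | rfl | hab
      · exact (value_confluent hn hG hg ih hab hb hd hd' hx h).symm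
      · rw [hux z h]
      · exact value_confluent hn hG hg ih hab ha hd' hd h hx

/-- Left multiplication by a generator, in terms of inverses. -/
theorem Value.generator_mul (hn : 2 ≤ n) (hG : Relations n G) {g : Function.End ℤ}
    (hg : IsInvPos n g) {a : ℕ} (ha : a ≤ n - 1) {h : Function.End ℤ} (hh : IsInvPos n h)
    (e : h * act n a = g) {x : N} (hx : Value n G g x) : Value n G h (G a * x) := by
  subst e
  rcases Nat.eq_zero_or_pos a with rfl | hpos
  · exact .step ha (hg.nonpos 0 le_rfl) hx
  · by_cases hd : IsDescent h a
    · exact .step ha hd hx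
    · have hd' := (isDescent_mul_act_self hh hpos ha).2 hd
      obtain ⟨y, hy, -⟩ := existsUnique_value hn hG hh
      have := (existsUnique_value hn hG hg).unique hx
        (.step ha hd' (by rw [mul_act_mul_act hn _ hpos ha]; exact hy))
      rw [this, ← mul_assoc, hG.sq _ hpos ha, one_mul]
      exact hy

end

/-! ### The monoid of positive affine permutations -/

section

variable {n : ℕ}

theorem act_mem (hn : 2 ≤ n) {a : ℕ} (ha : a ≤ n - 1) : act n a ∈ AffPos n := by
  refine ⟨act_bijective hn ha, act_add_period n a, fun x hx => ?_⟩
  rcases Nat.eq_zero_or_pos a with rfl | h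
  · rw [act_zero_apply]; omega
  · exact (act_pos_iff hn h ha x).2 hx

theorem exists_inverse (w : AffPos n) :
    ∃ g : Function.End ℤ, IsInvPos n g ∧ g * w = 1 ∧ (w : Function.End ℤ) * g = 1 := by
  obtain ⟨w, hb, hp, hpos⟩ := w
  let e := Equiv.ofBijective w hb
  have hwe : ∀ x, w (e.symm x) = x := e.apply_symm_apply
  refine ⟨(e.symm : ℤ → ℤ), ⟨e.symm.bijective, fun x => hb.1 ?_, fun x hx => ?_⟩,
    funext e.symm_apply_apply, funext e.apply_symm_apply⟩
  · rw [hwe, hp, hwe]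
  · by_contra! hc
    have := hpos _ hc
    rw [hwe] at this
    omega

theorem IsInvPos.exists_inverse {g : Function.End ℤ} (hg : IsInvPos n g) :
    ∃ w : AffPos n, g * w = 1 ∧ (w : Function.End ℤ) * g = 1 := by
  let e := Equiv.ofBijective g hg.bij
  have hge : ∀ x, g (e.symm x) = x := e.apply_symm_apply
  refine ⟨⟨(e.symm : ℤ → ℤ), e.symm.bijective, fun x => hg.bij.1 ?_, fun x hx => ?_⟩,
    funext e.apply_symm_apply, funext e.symm_apply_apply⟩
  · rw [hge, hg.periodic, hge]
  · by_contra! hc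
    have := hg.nonpos _ hc
    rw [hge] at this
    omega

/-- The generators form the set `{act n a | a ≤ n - 1}`. -/
theorem generators_eq (n : ℕ) :
    {x : AffPos n | (x : Function.End ℤ) = piF ∨
      ∃ i : ℕ, 1 ≤ i ∧ i ≤ n - 1 ∧ (x : Function.End ℤ) = sFun n i} =
    {x : AffPos n | ∃ a ≤ n - 1, (x : Function.End ℤ) = act n a} := by
  ext x
  constructor
  · rintro (h | ⟨i, hi, hin, h⟩)
    · exact ⟨0, Nat.zero_le _, h⟩
    · exact ⟨i, hin, h.trans (act_of_pos hi).symm⟩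
  · rintro ⟨a, ha, h⟩
    rcases Nat.eq_zero_or_pos a with rfl | hpos
    · exact Or.inl h
    · exact Or.inr ⟨a, hpos, ha, h.trans (act_of_pos hpos)⟩

theorem closure_generators (hn : 2 ≤ n) :
    Submonoid.closure {x : AffPos n | ∃ a ≤ n - 1, (x : Function.End ℤ) = act n a} = ⊤ := by
  rw [eq_top_iff]
  rintro w -
  obtain ⟨g, hg, hgw, hwg⟩ := exists_inverse w
  revert w
  refine IsInvPos.induction (p := fun g => ∀ w : AffPos n, g * w = 1 → w * g = 1 → w ∈ _)
    (fun g hg ih w hgw hwg => ?_) hg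
  by_cases h1 : g = 1
  · have : w = 1 := Subtype.ext (by simpa [h1] using hgw)
    rw [this]
    exact one_mem _
  · obtain ⟨a, ha, hd⟩ : ∃ a ≤ n - 1, IsDescent g a := by
      by_contra! hc
      exact h1 (hg.eq_one hn hc)
    have hga := hg.mul_act hn ha (by rintro rfl; exact hd)
    obtain ⟨v, hv, hv'⟩ := hga.exists_inverse
    have hmem := ih _ hga (lower_mul_act hn hg ha hd) v hv hv'
    have : w = ⟨act n a, act_mem hn ha⟩ * v := by
      refine Subtype.ext ?_
      calc (w : Function.End ℤ) = w * (g * act n a * v) := by rw [hv, mul_one]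
        _ = w * g * (act n a * v) := by simp only [mul_assoc]
        _ = act n a * v := by rw [hwg, one_mul]
    rw [this]
    exact mul_mem (Submonoid.subset_closure ⟨a, ha, rfl⟩) hmem

theorem exists_hom (hn : 2 ≤ n) {N : Type} [Monoid N] {G : ℕ → N} (hG : Relations n G) :
    ∃ φ : AffPos n →* N, ∀ (x : AffPos n) (a : ℕ), a ≤ n - 1 →
      (x : Function.End ℤ) = act n a → φ x = G a := by
  choose inv hinv hl hr using exists_inverse (n := n)
  choose f hf hu using fun w => existsUnique_value hn hG (hinv w)
  have hf1 : f 1 = 1 := by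
    have : inv 1 = 1 := by simpa using hl 1
    exact (hu 1 1 (this ▸ Value.one)).symm
  have hgen : ∀ (x : AffPos n) (a : ℕ), a ≤ n - 1 → (x : Function.End ℤ) = act n a →
      ∀ y, f (x * y) = G a * f y := by
    intro x a ha hx y
    refine (hu _ _ (Value.generator_mul hn hG (hinv y) ha (hinv _) ?_ (hf y))).symm
    calc inv (x * y) * act n a = inv (x * y) * (x * (y * inv y)) := by rw [hr, mul_one, hx]
      _ = inv (x * y) * ((x * y : AffPos n) : Function.End ℤ) * inv y := by
        simp only [Submonoid.coe_mul, mul_assoc]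
      _ = inv y := by rw [hl, one_mul]
  have hmul : ∀ x y, f (x * y) = f x * f y := by
    intro x
    have hx : x ∈ Submonoid.closure
        {x : AffPos n | ∃ a ≤ n - 1, (x : Function.End ℤ) = act n a} := by
      rw [closure_generators hn]; trivial
    induction hx using Submonoid.closure_induction_left with
    | one => intro y; rw [hf1, one_mul, one_mul]
    | mul_left x hx z _ ih =>
      obtain ⟨a, ha, hx⟩ := hx
      intro y
      rw [mul_assoc, hgen x a ha hx, ih, hgen x a ha hx, mul_assoc]
  refine ⟨⟨⟨f, hf1⟩, hmul⟩, fun x a ha hx => ?_⟩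
  show f x = G a
  have := hgen x a ha hx 1
  rwa [mul_one, hf1, mul_one] at this

end

end AffPos

/-- the monoid of positive affine permutations is generated by
`s_1, …, s_{n−1}` and `π`, subject only to the relations of `S_n` among the
`s_i` together with `s_i π = π s_{i−1}` (`2 ≤ i ≤ n−1`) and
`s_1 π² = π² s_{n−1}`: the relations hold, the elements generate, and the
corresponding universal property (existence and uniqueness of a monoid
homomorphism realizing any other solution of the relations) holds. -/
theorem stmt_18 (n : ℕ) (hn : 2 ≤ n) :
    (∀ i : ℕ, 1 ≤ i → i ≤ n - 1 → sFun n i ∘ sFun n i = id) ∧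
    (∀ i : ℕ, 1 ≤ i → i + 1 ≤ n - 1 →
      sFun n i ∘ sFun n (i + 1) ∘ sFun n i = sFun n (i + 1) ∘ sFun n i ∘ sFun n (i + 1)) ∧
    (∀ i j : ℕ, 1 ≤ i → j ≤ n - 1 → i + 1 < j →
      sFun n i ∘ sFun n j = sFun n j ∘ sFun n i) ∧
    (∀ i : ℕ, 2 ≤ i → i ≤ n - 1 → sFun n i ∘ piF = piF ∘ sFun n (i - 1)) ∧
    (sFun n 1 ∘ (piF ∘ piF) = (piF ∘ piF) ∘ sFun n (n - 1)) ∧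
    (Submonoid.closure {x : AffPos n | (x : Function.End ℤ) = piF ∨
        ∃ i : ℕ, 1 ≤ i ∧ i ≤ n - 1 ∧ (x : Function.End ℤ) = sFun n i} = ⊤) ∧
    (∀ (N : Type) [Monoid N], ∀ (S : ℕ → N) (P : N),
      (∀ i, 1 ≤ i → i ≤ n - 1 → S i * S i = 1) →
      (∀ i, 1 ≤ i → i + 1 ≤ n - 1 → S i * S (i + 1) * S i = S (i + 1) * S i * S (i + 1)) →
      (∀ i j, 1 ≤ i → j ≤ n - 1 → i + 1 < j → S i * S j = S j * S i) →
      (∀ i, 2 ≤ i → i ≤ n - 1 → S i * P = P * S (i - 1)) →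
      (S 1 * (P * P) = (P * P) * S (n - 1)) →
      ∃! φ : AffPos n →* N,
        (∀ (x : AffPos n) (i : ℕ), 1 ≤ i → i ≤ n - 1 →
          (x : Function.End ℤ) = sFun n i → φ x = S i) ∧
        (∀ x : AffPos n, (x : Function.End ℤ) = piF → φ x = P)) := by
  have hR := AffPos.act_relations hn
  have hs : ∀ i : ℕ, 1 ≤ i → AffPos.act n i = sFun n i := fun i hi => AffPos.act_of_pos hi
  refine ⟨fun i hi hin => ?_, fun i hi hin => ?_, fun i j hi hj hij => ?_, fun i hi hin => ?_,
    ?_, ?_, ?_⟩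
  · rw [← hs i hi]
    exact hR.sq i hi hin
  · rw [← hs i hi, ← hs (i + 1) (by omega)]
    exact hR.braid i hi hin
  · rw [← hs i hi, ← hs j (by omega)]
    exact hR.comm i j hi hj hij
  · rw [← hs i (by omega), ← hs (i - 1) (by omega)]
    exact hR.shift i hi hin
  · rw [← hs 1 le_rfl, ← hs (n - 1) (by omega)]
    exact hR.wrap
  · rw [AffPos.generators_eq n]
    exact AffPos.closure_generators hn
  · intro N _ S P hsq hbraid hcomm hshift hwrap
    let G : ℕ → N := fun a => if a = 0 then P else S a
    have hG0 : G 0 = P := if_pos rfl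
    have hGS : ∀ i, 1 ≤ i → G i = S i := fun i hi => if_neg (by omega)
    have hG : AffPos.Relations n G := by
      refine ⟨fun i hi hin => ?_, fun i hi hin => ?_, fun i j hi hj hij => ?_,
        fun i hi hin => ?_, ?_⟩
      · rw [hGS i hi, hsq i hi hin]
      · rw [hGS i hi, hGS (i + 1) (by omega), hbraid i hi hin]
      · rw [hGS i hi, hGS j (by omega), hcomm i j hi hj hij]
      · rw [hGS i (by omega), hGS (i - 1) (by omega), hG0, hshift i hi hin]
      · rw [hGS 1 le_rfl, hGS (n - 1) (by omega), hG0, hwrap]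
    obtain ⟨φ, hφ⟩ := AffPos.exists_hom hn hG
    refine ⟨φ, ⟨fun x i hi hin hx => ?_, fun x hx => ?_⟩, fun ψ hψ => ?_⟩
    · rw [hφ x i hin (hx.trans (hs i hi).symm), hGS i hi]
    · rw [hφ x 0 (Nat.zero_le _) hx, hG0]
    · refine MonoidHom.eq_of_eqOn_denseM (AffPos.closure_generators hn) ?_
      rintro x ⟨a, ha, hx⟩
      rw [hφ x a ha hx]
      rcases Nat.eq_zero_or_pos a with rfl | hpos
      · rw [hψ.2 x hx, hG0]
      · rw [hψ.1 x a hpos ha (hx.trans (hs a hpos)), hGS a hpos]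
end
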